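/- Let T be a text of length n over a finite totally ordered alphabet Σ. Then |st-lex^-| ≤ r and |st-lex^+| ≤ r; that is, each of the two sets {i + LPF_{ISA}[i] : i ∈ [n]} and {i + LPF_{π̄}[i] : i ∈ [n]}, with π̄(i) = n − ISA(i) + 1, has cardinality at most r, the number of maximal equal-symbol runs of the Burrows–Wheeler transform of T. -/

import Mathlib

/-!
Common definitions: strings are modeled as functions `S : ℕ → A` with 1-based
positions `1,…,n`; patterns/substrings as `List A`.
-/

open scoped Classical

/-- Length of the longest common prefix of the suffixes `S[i,n]` and `S[j,n]`
(1-based indexing): the largest `k` with `i+k-1 ≤ n`, `j+k-1 ≤ n` and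
`S[i,i+k-1] = S[j,j+k-1]`. -/
noncomputable def rlce {A : Type*} (S : ℕ → A) (n i j : ℕ) : ℕ :=
  Nat.findGreatest
    (fun k => i + k ≤ n + 1 ∧ j + k ≤ n + 1 ∧ ∀ t < k, S (i + t) = S (j + t)) n

/-- `π` is order-preserving for the string `S[1,n]`: whenever `π i < π j` and
`S[i,i+1] = S[j,j+1]` (for `i, j ∈ [n-1]`), also `π (i+1) < π (j+1)`. -/
def OrderPres {A : Type*} (S : ℕ → A) (n : ℕ) (π : ℕ → ℕ) : Prop :=
  ∀ i j, 1 ≤ i → i < n → 1 ≤ j → j < n → π i < π j →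
    S i = S j → S (i + 1) = S (j + 1) → π (i + 1) < π (j + 1)

/-- `π` is a permutation of `{1,…,n}`. -/
def PermOn (π : ℕ → ℕ) (n : ℕ) : Prop :=
  Set.BijOn π (Set.Icc 1 n) (Set.Icc 1 n)

/-- Generalized Longest Previous Factor array `LPF_π` of `S[1,n]`:
`LPF_π[i] = 0` if `π i = 1`, and `LPF_π[i] = max { rlce(j,i) : j ∈ [n], π j < π i }`
otherwise. -/
noncomputable def LPF {A : Type*} (S : ℕ → A) (n : ℕ) (π : ℕ → ℕ) (i : ℕ) : ℕ :=
  if π i = 1 then 0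
  else ((Finset.Icc 1 n).filter (fun j => π j < π i)).sup (fun j => rlce S n j i)

/-- `i` is an irreducible `LPF_π` position: `i = 1` or `LPF_π[i] ≠ LPF_π[i-1] - 1`
(the right-hand side taken over the integers). -/
def Irr {A : Type*} (S : ℕ → A) (n : ℕ) (π : ℕ → ℕ) (i : ℕ) : Prop :=
  i = 1 ∨ (LPF S n π i : ℤ) ≠ (LPF S n π (i - 1) : ℤ) - 1

/-- The Path Decomposition Array `PDA_π = { i + LPF_π[i] : i ∈ [n] }`, as a finite set. -/
noncomputable def PDA {A : Type*} (S : ℕ → A) (n : ℕ) (π : ℕ → ℕ) : Finset ℕ :=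
  (Finset.Icc 1 n).image (fun i => i + LPF S n π i)

/-- The string `w` occurs in `S` starting at (1-based) position `i`. -/
def occursAt {A : Type*} (S : ℕ → A) (w : List A) (i : ℕ) : Prop :=
  ∀ (t : ℕ) (ht : t < w.length), S (i + t) = w.get ⟨t, ht⟩

/-- `w` is a substring of `S[1,n]`. -/
def IsSubstr {A : Type*} (S : ℕ → A) (n : ℕ) (w : List A) : Prop :=
  ∃ i, 1 ≤ i ∧ i + w.length ≤ n + 1 ∧ occursAt S w i

/-- `w` is a suffix of the prefix `S[1,j]`. -/
def SuffixOfPrefix {A : Type*} (S : ℕ → A) (w : List A) (j : ℕ) : Prop :=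
  w.length ≤ j ∧ occursAt S w (j - w.length + 1)

/-- `w` is a right-maximal substring of `S[1,n]`: it is a substring of `S[1,n]` and
either a suffix of `S[1,n]`, or it has two distinct one-character right-extensions
occurring in `S[1,n]`. -/
def RightMaximal {A : Type*} (S : ℕ → A) (n : ℕ) (w : List A) : Prop :=
  IsSubstr S n w ∧
    (SuffixOfPrefix S w n ∨
      ∃ a b : A, a ≠ b ∧ IsSubstr S n (w ++ [a]) ∧ IsSubstr S n (w ++ [b]))

/-- `T[1,n]` is a text: `n ≥ 1` and the terminator `T n` is strictly smaller than
(in particular, different from) every other symbol of the text. -/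
def IsText {A : Type*} [LT A] (T : ℕ → A) (n : ℕ) : Prop :=
  1 ≤ n ∧ ∀ i, 1 ≤ i → i < n → T n < T i

/-- The suffix `S[i,n]` as a list. -/
def sufList {A : Type*} (S : ℕ → A) (n i : ℕ) : List A :=
  (List.range (n + 1 - i)).map (fun t => S (i + t))

/-- The prefix `S[1,i]` as a list. -/
def preList {A : Type*} (S : ℕ → A) (i : ℕ) : List A :=
  (List.range i).map (fun t => S (1 + t))

/-- `SA` is the suffix array of `T[1,n]`: a permutation of `[n]` listing the starting
positions of the suffixes of `T` in increasing lexicographic order. -/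
def IsSA {A : Type*} [LinearOrder A] (T : ℕ → A) (n : ℕ) (SA : ℕ → ℕ) : Prop :=
  PermOn SA n ∧ ∀ i j, 1 ≤ i → i < j → j ≤ n →
    List.Lex (· < ·) (sufList T n (SA i)) (sufList T n (SA j))

/-- `g` is the inverse of `f` on `{1,…,n}`. -/
def IsInv (f g : ℕ → ℕ) (n : ℕ) : Prop :=
  (∀ i, 1 ≤ i → i ≤ n → g (f i) = i) ∧ (∀ i, 1 ≤ i → i ≤ n → f (g i) = i)

/-- `PA` is the prefix array of `T[1,n]`: a permutation of `[n]` listing the ending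
positions of the prefixes of `T` in increasing colexicographic order. -/
def IsPA {A : Type*} [LinearOrder A] (T : ℕ → A) (n : ℕ) (PA : ℕ → ℕ) : Prop :=
  PermOn PA n ∧ ∀ i j, 1 ≤ i → i < j → j ≤ n →
    List.Lex (· < ·) (preList T (PA i)).reverse (preList T (PA j)).reverse

/-- The Burrows–Wheeler transform: `BWT[i] = T[SA[i] - 1]`, with the convention
`T[0] := T[n]`. -/
def BWT {A : Type*} (T : ℕ → A) (n : ℕ) (SA : ℕ → ℕ) (i : ℕ) : A :=
  T (if SA i = 1 then n else SA i - 1)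

/-- The co-Burrows–Wheeler transform: `coBWT[i] = T[PA[i] + 1]`, with the convention
`T[n+1] := T[1]`. -/
def coBWT {A : Type*} (T : ℕ → A) (n : ℕ) (PA : ℕ → ℕ) (i : ℕ) : A :=
  T (if PA i = n then 1 else PA i + 1)

/-- Number of maximal equal-symbol runs of `B[1,n]` (for `n ≥ 1`). -/
noncomputable def runs {A : Type*} (B : ℕ → A) (n : ℕ) : ℕ :=
  1 + ((Finset.Icc 2 n).filter (fun i => B i ≠ B (i - 1))).card

theorem rlce_spec {A : Type*} (S : ℕ → A) (n i j : ℕ) (hi : i ≤ n) (hj : j ≤ n) :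
    i + rlce S n i j ≤ n + 1 ∧ j + rlce S n i j ≤ n + 1 ∧
      ∀ t < rlce S n i j, S (i + t) = S (j + t) := by
  unfold rlce
  exact Nat.findGreatest_spec (P := fun k => i + k ≤ n + 1 ∧ j + k ≤ n + 1 ∧
    ∀ t < k, S (i + t) = S (j + t)) (Nat.zero_le n) ⟨by omega, by omega, by intro t ht; omega⟩

theorem le_rlce {A : Type*} (S : ℕ → A) (n i j k : ℕ) (hi : 1 ≤ i) (h1 : i + k ≤ n + 1)
    (h2 : j + k ≤ n + 1) (h : ∀ t < k, S (i + t) = S (j + t)) : k ≤ rlce S n i j := by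
  unfold rlce
  exact Nat.le_findGreatest (P := fun k => i + k ≤ n + 1 ∧ j + k ≤ n + 1 ∧
    ∀ t < k, S (i + t) = S (j + t)) (by omega) ⟨h1, h2, h⟩

theorem LPF_eq_sup {A : Type*} (S : ℕ → A) (n : ℕ) (π : ℕ → ℕ) (i : ℕ)
    (hπ : ∀ i, 1 ≤ i → i ≤ n → 1 ≤ π i) :
    LPF S n π i = ((Finset.Icc 1 n).filter (fun j => π j < π i)).sup (fun j => rlce S n j i) := by
  unfold LPF
  split_ifs with h
  · have : (Finset.Icc 1 n).filter (fun j => π j < π i) = ∅ := by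
      ext j
      simp only [Finset.mem_filter, Finset.mem_Icc, Finset.notMem_empty, iff_false]
      rintro ⟨⟨h1, h2⟩, h3⟩
      have := hπ j h1 h2
      omega
    rw [this]; simp
  · rfl

theorem rlce_succ {A : Type*} (S : ℕ → A) (n i j : ℕ) (hi1 : 1 ≤ i) (hi : i < n) (hj1 : 1 ≤ j)
    (hj : j < n) (h : S i = S j) : rlce S n i j = rlce S n (i+1) (j+1) + 1 := by
  apply le_antisymm
  · obtain ⟨h1, h2, h3⟩ := rlce_spec S n i j hi.le hj.le
    rcases Nat.eq_zero_or_pos (rlce S n i j) with h0 | h0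
    · omega
    · have := le_rlce S n (i+1) (j+1) (rlce S n i j - 1) (by omega) (by omega) (by omega) (by
        intro t ht
        have := h3 (t+1) (by omega)
        rw [show i + 1 + t = i + (t+1) by omega, show j + 1 + t = j + (t+1) by omega]; exact this)
      omega
  · obtain ⟨h1, h2, h3⟩ := rlce_spec S n (i+1) (j+1) hi hj
    apply le_rlce S n i j _ hi1 (by omega) (by omega)
    intro t ht
    cases t with
    | zero => simpa using h
    | succ t =>
      have := h3 t (by omega)
      rw [show i + (t+1) = i + 1 + t by omega, show j + (t+1) = j + 1 + t by omega]; exact this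

theorem pda_core {A : Type*} (T : ℕ → A) (n : ℕ) (hn : 1 ≤ n)
    (huniq : ∀ i, 1 ≤ i → i < n → T n ≠ T i) (π σ : ℕ → ℕ)
    (hσ : ∀ p, 1 ≤ p → p ≤ n → 1 ≤ σ p ∧ σ p ≤ n ∧ π (σ p) = p)
    (hπ : ∀ p, 1 ≤ p → p ≤ n → 1 ≤ π p ∧ π p ≤ n ∧ σ (π p) = p)
    (hord : ∀ i j, 1 ≤ i → i < n → 1 ≤ j → j < n → T i = T j →
      (π i < π j ↔ π (i+1) < π (j+1)))
    (hconv : ∀ a b c, 1 ≤ a → a ≤ n → 1 ≤ b → b ≤ n → 1 ≤ c → c ≤ n → π a < π b → π b < π c →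
      rlce T n a c ≤ rlce T n b c) :
    (PDA T n π).card ≤ runs (BWT T n σ) n := by
  have hL := fun i => LPF_eq_sup T n π i (fun i h1 h2 => (hπ i h1 h2).1)
  have hLge : ∀ i j, 1 ≤ j → j ≤ n → π j < π i → rlce T n j i ≤ LPF T n π i := by
    intro i j h1 h2 h3
    rw [hL]
    exact Finset.le_sup (f := fun j => rlce T n j i) (by simp [h1, h2, h3])
  have step : ∀ i, 1 ≤ i → i + 1 ≤ n → 2 ≤ π (i+1) →
      BWT T n σ (π (i+1)) = BWT T n σ (π (i+1) - 1) →
      i + LPF T n π i = i + 1 + LPF T n π (i+1) := by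
    intro i hi hin hp hB
    obtain ⟨hp1, hp2, hp3⟩ := hπ (i+1) (by omega) hin
    obtain ⟨hj1, hj2, hj3⟩ := hσ (π (i+1) - 1) (by omega) (by omega)
    unfold BWT at hB
    rw [hp3, if_neg (by omega)] at hB
    simp only [Nat.add_sub_cancel] at hB
    generalize hj : σ (π (i+1) - 1) = j at *
    split_ifs at hB with h1
    · exact absurd hB.symm (huniq i hi (by omega))
    obtain ⟨k, rfl⟩ : ∃ k, j = k + 1 := ⟨j - 1, by omega⟩
    simp only [Nat.add_sub_cancel] at hB
    have hlt : π (k+1) < π (i+1) := by omega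
    have hadj : LPF T n π (i+1) ≤ rlce T n (k+1) (i+1) := by
      rw [hL]
      apply Finset.sup_le
      intro a ha
      simp only [Finset.mem_filter, Finset.mem_Icc] at ha
      obtain ⟨⟨ha1, ha2⟩, ha3⟩ := ha
      rcases Nat.lt_or_ge (π a) (π (k+1)) with h | h
      · exact hconv a (k+1) (i+1) ha1 ha2 hj1 hj2 (by omega) hin h hlt
      · have : π a = π (k+1) := by omega
        have e1 := (hπ a ha1 ha2).2.2
        have e2 := (hπ (k+1) hj1 hj2).2.2
        rw [this, e2] at e1
        rw [e1]
    have hadj' := hLge i k (by omega) (by omega)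
      ((hord k i (by omega) (by omega) hi (by omega) hB.symm).2 hlt)
    rw [rlce_succ T n k i (by omega) (by omega) hi (by omega) hB.symm] at hadj'
    have hup : LPF T n π i ≤ LPF T n π (i+1) + 1 := by
      rw [hL i]
      apply Finset.sup_le
      intro a ha
      simp only [Finset.mem_filter, Finset.mem_Icc] at ha
      obtain ⟨⟨ha1, ha2⟩, ha3⟩ := ha
      rcases Nat.eq_zero_or_pos (rlce T n a i) with h0 | h0
      · omega
      · have hTa := (rlce_spec T n a i ha2 (by omega)).2.2 0 h0
        simp only [Nat.add_zero] at hTa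
        have han : a < n := by
          rcases Nat.lt_or_ge a n with h | h
          · exact h
          · have : a = n := by omega
            rw [this] at hTa
            exact absurd hTa (huniq i hi (by omega))
        rw [rlce_succ T n a i ha1 han hi (by omega) hTa]
        have := hLge (i+1) (a+1) (by omega) (by omega)
          ((hord a i ha1 han hi (by omega) hTa).1 ha3)
        omega
    omega
  have key : ∀ i, 1 ≤ i → i ≤ n → ∃ p ∈ insert 1 ((Finset.Icc 2 n).filter
      (fun i => BWT T n σ i ≠ BWT T n σ (i - 1))), σ p + LPF T n π (σ p) = i + LPF T n π i := by
    intro i hi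
    induction i, hi using Nat.le_induction with
    | base =>
      intro _
      obtain ⟨h1, h2, h3⟩ := hπ 1 le_rfl hn
      refine ⟨π 1, ?_, by rw [h3]⟩
      rcases Nat.lt_or_ge 1 (π 1) with h | h
      · refine Finset.mem_insert_of_mem ?_
        simp only [Finset.mem_filter, Finset.mem_Icc]
        refine ⟨⟨h, h2⟩, ?_⟩
        obtain ⟨hj1, hj2, hj3⟩ := hσ (π 1 - 1) (by omega) (by omega)
        have hne : σ (π 1 - 1) ≠ 1 := by
          intro he
          rw [he] at hj3
          omega
        unfold BWT
        rw [h3, if_pos rfl, if_neg hne]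
        exact huniq _ (by omega) (by omega)
      · have : π 1 = 1 := by omega
        rw [this]; exact Finset.mem_insert_self _ _
    | succ i hi ih =>
      intro hin
      obtain ⟨h1, h2, h3⟩ := hπ (i+1) (by omega) hin
      by_cases hc : 2 ≤ π (i+1) ∧ BWT T n σ (π (i+1)) = BWT T n σ (π (i+1) - 1)
      · rw [← step i hi hin hc.1 hc.2]
        exact ih (by omega)
      · refine ⟨π (i+1), ?_, by rw [h3]⟩
        rw [Finset.mem_insert, Finset.mem_filter, Finset.mem_Icc]
        by_cases h : 2 ≤ π (i+1)
        · exact Or.inr ⟨⟨h, h2⟩, fun hh => hc ⟨h, hh⟩⟩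
        · left; omega
  have hsub : PDA T n π ⊆ (insert 1 ((Finset.Icc 2 n).filter
      (fun i => BWT T n σ i ≠ BWT T n σ (i - 1)))).image (fun p => σ p + LPF T n π (σ p)) := by
    intro x hx
    unfold PDA at hx
    simp only [Finset.mem_image, Finset.mem_Icc] at hx
    obtain ⟨i, ⟨h1, h2⟩, rfl⟩ := hx
    obtain ⟨p, hp, he⟩ := key i h1 h2
    exact Finset.mem_image.2 ⟨p, hp, he⟩
  refine (Finset.card_le_card hsub).trans (Finset.card_image_le.trans ?_)
  refine (Finset.card_insert_le _ _).trans ?_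
  unfold runs
  omega

theorem runs_rev {A : Type*} (B : ℕ → A) (n : ℕ) :
    runs (fun p => B (n - p + 1)) n ≤ runs B n := by
  unfold runs
  refine Nat.add_le_add_left ?_ 1
  refine Finset.card_le_card_of_injOn (fun p => n - p + 2) ?_ ?_
  · intro p hp
    simp only [Finset.coe_filter, Finset.mem_Icc, Set.mem_setOf_eq] at hp ⊢
    obtain ⟨⟨h1, h2⟩, h3⟩ := hp
    refine ⟨by omega, ?_⟩
    rw [show n - (p - 1) + 1 = n - p + 2 by omega] at h3
    rw [show n - p + 2 - 1 = n - p + 1 by omega]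
    exact h3.symm
  · intro p hp q hq h
    simp only [Finset.coe_filter, Finset.mem_Icc, Set.mem_setOf_eq] at hp hq h
    omega

/-- strict order of suffixes -/
def sless {A : Type*} [LinearOrder A] (T : ℕ → A) (n i j : ℕ) : Prop :=
  ∃ k, i + k ≤ n ∧ j + k ≤ n ∧ (∀ t < k, T (i + t) = T (j + t)) ∧ T (i + k) < T (j + k)

theorem sless_agree {A : Type*} [LinearOrder A] (T : ℕ → A) (n a b c m : ℕ)
    (h1 : sless T n a b) (h2 : sless T n b c) (h : ∀ t < m, T (a + t) = T (c + t)) :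
    b + m ≤ n ∧ (∀ t < m, T (a + t) = T (b + t)) ∧ (∀ t < m, T (b + t) = T (c + t)) := by
  obtain ⟨k, hk1, hk2, hk3, hk4⟩ := h1
  obtain ⟨l, hl1, hl2, hl3, hl4⟩ := h2
  have hmin : m ≤ k ∧ m ≤ l := by
    by_contra hcon
    rcases lt_trichotomy k l with hkl | hkl | hkl
    · have e := hl3 k hkl
      have e' := h k (by omega)
      rw [e, e'] at hk4
      exact lt_irrefl _ hk4
    · subst hkl
      have e' := h k (by omega)
      rw [e'] at hk4
      exact lt_irrefl _ (hk4.trans hl4)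
    · have e := hk3 l hkl
      have e' := h l (by omega)
      rw [← e, e'] at hl4
      exact lt_irrefl _ hl4
  exact ⟨by omega, fun t ht => hk3 t (by omega), fun t ht => hl3 t (by omega)⟩

theorem sless_asymm {A : Type*} [LinearOrder A] (T : ℕ → A) (n a b : ℕ)
    (h1 : sless T n a b) (h2 : sless T n b a) : False := by
  have := (sless_agree T n a b a (n+1) h1 h2 (fun _ _ => rfl)).1
  omega

theorem sless_succ {A : Type*} [LinearOrder A] (T : ℕ → A) (n i j : ℕ) (h : T i = T j)
    (hs : sless T n i j) : sless T n (i+1) (j+1) := by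
  obtain ⟨k, hk1, hk2, hk3, hk4⟩ := hs
  cases k with
  | zero => simp [h] at hk4
  | succ k =>
    refine ⟨k, by omega, by omega, fun t ht => ?_, ?_⟩
    · rw [show i + 1 + t = i + (t+1) by omega, show j + 1 + t = j + (t+1) by omega]
      exact hk3 _ (by omega)
    · rw [show i + 1 + k = i + (k+1) by omega, show j + 1 + k = j + (k+1) by omega]
      exact hk4

theorem sufList_cons {A : Type*} (T : ℕ → A) (n i : ℕ) (h : i ≤ n) :
    sufList T n i = T i :: sufList T n (i+1) := by
  unfold sufList
  rw [show n + 1 - i = (n + 1 - (i+1)) + 1 by omega, List.range_succ_eq_map]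
  simp only [List.map_cons, List.map_map, Nat.add_zero, List.cons.injEq, true_and]
  apply List.map_congr_left
  intro t _
  simp only [Function.comp]
  congr 1
  omega

theorem sufList_nil {A : Type*} (T : ℕ → A) (n i : ℕ) (h : n < i) :
    sufList T n i = [] := by
  unfold sufList
  rw [show n + 1 - i = 0 by omega]; rfl

theorem lex_sufList {A : Type*} [LinearOrder A] (T : ℕ → A) (n : ℕ) : ∀ d i j, n + 1 - i = d →
    i ≤ n + 1 → List.Lex (· < ·) (sufList T n i) (sufList T n j) →
    ∃ k, i + k ≤ n + 1 ∧ j + k ≤ n ∧ (∀ t < k, T (i + t) = T (j + t)) ∧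
      (i + k = n + 1 ∨ T (i + k) < T (j + k)) := by
  intro d
  induction d with
  | zero =>
    intro i j hd hi hlex
    rw [sufList_nil T n i (by omega)] at hlex
    rcases Nat.lt_or_ge n j with h | h
    · rw [sufList_nil T n j h] at hlex
      cases hlex
    · exact ⟨0, by omega, by omega, by intro t ht; omega, by left; omega⟩
  | succ d ih =>
    intro i j hd hi hlex
    rw [sufList_cons T n i (by omega)] at hlex
    rcases Nat.lt_or_ge n j with h | h
    · rw [sufList_nil T n j h] at hlex
      cases hlex
    · rw [sufList_cons T n j h] at hlex
      have hlex' : T i < T j ∨ (T i = T j ∧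
          List.Lex (· < ·) (sufList T n (i+1)) (sufList T n (j+1))) := by
        generalize T i = x at hlex ⊢
        generalize T j = y at hlex ⊢
        cases hlex with
        | rel h => exact Or.inl h
        | cons h => exact Or.inr ⟨rfl, h⟩
      rcases hlex' with hl | ⟨he, hl⟩
      · exact ⟨0, by omega, by omega, by intro t ht; omega, by right; simpa using hl⟩
      · obtain ⟨k, h1, h2, h3, h4⟩ := ih (i+1) (j+1) (by omega) (by omega) hl
        refine ⟨k+1, by omega, by omega, ?_, ?_⟩
        · intro t ht
          cases t with
          | zero => simpa using he
          | succ t =>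
            rw [show i + (t+1) = i + 1 + t by omega, show j + (t+1) = j + 1 + t by omega]
            exact h3 t (by omega)
        · rw [show i + (k+1) = i + 1 + k by omega, show j + (k+1) = j + 1 + k by omega]
          exact h4

theorem lex_sless {A : Type*} [LinearOrder A] (T : ℕ → A) (n i j : ℕ)
    (huniq : ∀ i, 1 ≤ i → i < n → T n ≠ T i) (hi : i ≤ n) (hj1 : 1 ≤ j)
    (h : List.Lex (· < ·) (sufList T n i) (sufList T n j)) : sless T n i j := by
  obtain ⟨k, h1, h2, h3, h4⟩ := lex_sufList T n _ i j rfl (by omega) h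
  have : i + k ≠ n + 1 := by
    intro he
    have e := h3 (k-1) (by omega)
    rw [show i + (k-1) = n by omega] at e
    exact huniq _ (by omega) (by omega) e
  exact ⟨k, by omega, h2, h3, h4.resolve_left this⟩

/-- `|st-lex⁻| ≤ r` and `|st-lex⁺| ≤ r`: the sets
`{i + LPF_ISA[i] : i ∈ [n]}` and `{i + LPF_π̄[i] : i ∈ [n]}` (with `π̄ i = n - ISA i + 1`)
each have cardinality at most the number of runs of the Burrows–Wheeler transform. -/
theorem stlex_le_runs {A : Type*} [Fintype A] [LinearOrder A]
    (T : ℕ → A) (n : ℕ) (htext : IsText T n)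
    (SA ISA : ℕ → ℕ) (hSA : IsSA T n SA) (hISA : IsInv SA ISA n) :
    (PDA T n ISA).card ≤ runs (BWT T n SA) n ∧
    (PDA T n (fun i => n - ISA i + 1)).card ≤ runs (BWT T n SA) n := by
  obtain ⟨hn, hlt⟩ := htext
  obtain ⟨hperm, hlex⟩ := hSA
  obtain ⟨hinv1, hinv2⟩ := hISA
  have huniq : ∀ i, 1 ≤ i → i < n → T n ≠ T i := fun i h1 h2 => (hlt i h1 h2).ne
  have hσ : ∀ p, 1 ≤ p → p ≤ n → 1 ≤ SA p ∧ SA p ≤ n ∧ ISA (SA p) = p := by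
    intro p h1 h2
    have := hperm.mapsTo (Set.mem_Icc.2 ⟨h1, h2⟩)
    exact ⟨this.1, this.2, hinv1 p h1 h2⟩
  have hπ : ∀ p, 1 ≤ p → p ≤ n → 1 ≤ ISA p ∧ ISA p ≤ n ∧ SA (ISA p) = p := by
    intro p h1 h2
    obtain ⟨q, hq, rfl⟩ := hperm.surjOn (Set.mem_Icc.2 ⟨h1, h2⟩)
    rw [hinv1 q hq.1 hq.2]
    exact ⟨hq.1, hq.2, rfl⟩
  have hs : ∀ i j, 1 ≤ i → i ≤ n → 1 ≤ j → j ≤ n → ISA i < ISA j → sless T n i j := by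
    intro i j hi1 hi2 hj1 hj2 h
    have := hlex (ISA i) (ISA j) (hπ i hi1 hi2).1 h (hπ j hj1 hj2).2.1
    rw [(hπ i hi1 hi2).2.2, (hπ j hj1 hj2).2.2] at this
    exact lex_sless T n i j huniq hi2 hj1 this
  have hinj : ∀ i j, 1 ≤ i → i ≤ n → 1 ≤ j → j ≤ n → ISA i = ISA j → i = j := by
    intro i j hi1 hi2 hj1 hj2 h
    rw [← (hπ i hi1 hi2).2.2, h, (hπ j hj1 hj2).2.2]
  have hf : ∀ i j, 1 ≤ i → i < n → 1 ≤ j → j < n → T i = T j → ISA i < ISA j →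
      ISA (i+1) < ISA (j+1) := by
    intro i j hi1 hi2 hj1 hj2 hT h
    have h1 := sless_succ T n i j hT (hs i j hi1 hi2.le hj1 hj2.le h)
    rcases lt_trichotomy (ISA (i+1)) (ISA (j+1)) with h2 | h2 | h2
    · exact h2
    · have := hinj _ _ (by omega) (by omega) (by omega) (by omega) h2
      have : i = j := by omega
      subst this
      omega
    · exact (sless_asymm T n _ _ h1
        (hs _ _ (by omega) (by omega) (by omega) (by omega) h2)).elim
  have hord : ∀ i j, 1 ≤ i → i < n → 1 ≤ j → j < n → T i = T j →
      (ISA i < ISA j ↔ ISA (i+1) < ISA (j+1)) := by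
    intro i j hi1 hi2 hj1 hj2 hT
    refine ⟨hf i j hi1 hi2 hj1 hj2 hT, fun h => ?_⟩
    rcases lt_trichotomy (ISA i) (ISA j) with h2 | h2 | h2
    · exact h2
    · have := hinj _ _ hi1 hi2.le hj1 hj2.le h2
      subst this
      omega
    · have := hf j i hj1 hj2 hi1 hi2 hT.symm h2
      omega
  constructor
  · refine pda_core T n hn huniq ISA SA hσ hπ hord ?_
    intro a b c ha1 ha2 hb1 hb2 hc1 hc2 hab hbc
    obtain ⟨h1, h2, h3⟩ := rlce_spec T n a c ha2 hc2
    obtain ⟨g1, g2, g3⟩ := sless_agree T n a b c _ (hs a b ha1 ha2 hb1 hb2 hab)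
      (hs b c hb1 hb2 hc1 hc2 hbc) h3
    exact le_rlce T n b c _ hb1 (by omega) h2 g3
  · have hr : BWT T n (fun p => SA (n - p + 1)) = fun p => BWT T n SA (n - p + 1) := by
      funext p
      rfl
    refine le_trans ?_ (runs_rev (BWT T n SA) n)
    rw [← hr]
    refine pda_core T n hn huniq _ _ ?_ ?_ ?_ ?_
    · intro p h1 h2
      obtain ⟨k1, k2, k3⟩ := hσ (n - p + 1) (by omega) (by omega)
      refine ⟨k1, k2, ?_⟩
      simp only [k3]
      omega
    · intro p h1 h2
      obtain ⟨k1, k2, k3⟩ := hπ p h1 h2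
      refine ⟨by omega, by omega, ?_⟩
      rw [show n - (n - ISA p + 1) + 1 = ISA p by omega, k3]
    · intro i j hi1 hi2 hj1 hj2 hT
      have := hord j i hj1 hj2 hi1 hi2 hT.symm
      have b1 := hπ i hi1 hi2.le
      have b2 := hπ j hj1 hj2.le
      have b3 := hπ (i+1) (by omega) hi2
      have b4 := hπ (j+1) (by omega) hj2
      omega
    · intro a b c ha1 ha2 hb1 hb2 hc1 hc2 hab hbc
      have b1 := hπ a ha1 ha2
      have b2 := hπ b hb1 hb2
      have b3 := hπ c hc1 hc2
      obtain ⟨h1, h2, h3⟩ := rlce_spec T n a c ha2 hc2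
      obtain ⟨g1, g2, g3⟩ := sless_agree T n c b a _ (hs c b hc1 hc2 hb1 hb2 (by omega))
        (hs b a hb1 hb2 ha1 ha2 (by omega)) (fun t ht => (h3 t ht).symm)
      exact le_rlce T n b c _ hb1 (by omega) h2 (fun t ht => (g2 t ht).symm)
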